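/- (Second self-testing decomposition.) Let (ψ, (P_x^a), (Q_y^b)) be any finite-dimensional strategy inducing the ideal correlation p*. Then there exist k_A, k_B ≥ 1, isometries V_A : ℂ^{d_A} → ℂ³⊗ℂ^{k_A} and V_B : ℂ^{d_B} → ℂ³⊗ℂ^{k_B}, and unit vectors χ', χ'' : Fin k_A × Fin k_B → ℂ such that, under the canonical identification (ℂ³⊗ℂ^{k_A})⊗(ℂ³⊗ℂ^{k_B}) ≅ (ℂ³⊗ℂ³)⊗(ℂ^{k_A}⊗ℂ^{k_B}): (V_A⊗V_B)ψ = √(1−α²)·|22⟩⊗χ'' + (α/√(1+α²))·(|11⟩ + α|00⟩)⊗χ'; (V_A⊗V_B)((P_2^0⊗I)ψ) = (α²/√(1+α²))·|00⟩⊗χ'; (V_A⊗V_B)((P_2^1⊗I)ψ) = (α/√(1+α²))·|11⟩⊗χ'; and (V_A⊗V_B)((P_2^2⊗I)ψ) = √(1−α²)·|22⟩⊗χ''. -/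

import Mathlib

open Matrix Kronecker

noncomputable section

namespace Sep

/-- Pauli `σz`. -/
def sz : Matrix (Fin 2) (Fin 2) ℝ := !![1, 0; 0, -1]

/-- Pauli `σx`. -/
def sx : Matrix (Fin 2) (Fin 2) ℝ := !![0, 1; 1, 0]

/-- `μ = arctan (sin 2θ)` where `θ = arctan α`. -/
def mu (α : ℝ) : ℝ := Real.arctan (Real.sin (2 * Real.arctan α))

/-- The tilted Pauli `σαz`. -/
def saz (α : ℝ) : Matrix (Fin 2) (Fin 2) ℝ :=
  Real.cos (mu α) • sz + Real.sin (mu α) • sx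

/-- The tilted Pauli `σαx`. -/
def sax (α : ℝ) : Matrix (Fin 2) (Fin 2) ℝ :=
  Real.cos (mu α) • sz - Real.sin (mu α) • sx

/-- Orthogonal projection onto the `+1`-eigenspace of a symmetric involution `O`
(with eigenvalues `+1` and `-1`): `O⁺ = (I + O)/2`. -/
def pl (O : Matrix (Fin 2) (Fin 2) ℝ) : Matrix (Fin 2) (Fin 2) ℝ := (2 : ℝ)⁻¹ • (1 + O)

/-- Orthogonal projection onto the `-1`-eigenspace: `O⁻ = (I - O)/2`. -/
def mn (O : Matrix (Fin 2) (Fin 2) ℝ) : Matrix (Fin 2) (Fin 2) ℝ := (2 : ℝ)⁻¹ • (1 - O)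

/-- Embed a `2×2` matrix `O` as an `ℕ×ℕ` matrix supported on rows/columns `f 0, f 1`,
with entry `O r s` at position `(f r, f s)`. -/
def embed (f : Fin 2 → ℕ) (O : Matrix (Fin 2) (Fin 2) ℝ) : Matrix ℕ ℕ ℝ :=
  fun i j => ∑ r : Fin 2, ∑ s : Fin 2, if i = f r ∧ j = f s then O r s else 0

/-- `ev_m(O)`: supported on `{2m, 2m+1}`. -/
def evm (m : ℕ) (O : Matrix (Fin 2) (Fin 2) ℝ) : Matrix ℕ ℕ ℝ :=
  embed (fun r => 2 * m + (r : ℕ)) O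

/-- `od_m(O)`: supported on `{2m+1, 2m+2}`. -/
def odm (m : ℕ) (O : Matrix (Fin 2) (Fin 2) ℝ) : Matrix ℕ ℕ ℝ :=
  embed (fun r => 2 * m + 1 + (r : ℕ)) O

/-- Entrywise sum `Σ_m F m` of a family of `ℕ×ℕ` matrices. -/
def sumB (F : ℕ → Matrix ℕ ℕ ℝ) : Matrix ℕ ℕ ℝ := fun i j => ∑' m, F m i j

/-- The `ℕ×ℕ` matrix with a single `1` entry at `(0,0)`. -/
def E00 : Matrix ℕ ℕ ℝ := fun i j => if i = 0 ∧ j = 0 then 1 else 0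

/-- Alice's ideal operators `A_x^a`. -/
def Aop : Fin 4 → Fin 3 → Matrix ℕ ℕ ℝ :=
  ![![sumB (fun m => evm m (pl sz)), sumB (fun m => evm m (mn sz)), 0],
    ![sumB (fun m => evm m (pl sx)), sumB (fun m => evm m (mn sx)), 0],
    ![sumB (fun m => odm m (mn sz)), sumB (fun m => odm m (pl sz)), E00],
    ![sumB (fun m => odm m (mn sx)), sumB (fun m => odm m (pl sx)), E00]]

/-- Bob's ideal operators `B_y^b`. -/
def Bop (α : ℝ) : Fin 5 → Fin 3 → Matrix ℕ ℕ ℝ :=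
  ![![sumB (fun m => evm m (pl (saz α))), sumB (fun m => evm m (mn (saz α))), 0],
    ![sumB (fun m => evm m (pl (sax α))), sumB (fun m => evm m (mn (sax α))), 0],
    ![sumB (fun m => odm m (mn (saz α))), sumB (fun m => odm m (pl (saz α))), E00],
    ![sumB (fun m => odm m (mn (sax α))), sumB (fun m => odm m (pl (sax α))), E00],
    ![Aop 0 0, Aop 0 1, Aop 0 2]]

/-- The ideal correlation `p*(a,b|x,y) = (1-α²) Σ_{i,k} α^{i+k} A_x^a(i,k) B_y^b(i,k)`. -/
def pstar (α : ℝ) (x : Fin 4) (y : Fin 5) (a b : Fin 3) : ℝ :=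
  (1 - α ^ 2) * ∑' ik : ℕ × ℕ, α ^ (ik.1 + ik.2) * Aop x a ik.1 ik.2 * Bop α y b ik.1 ik.2

/-- A finite-dimensional strategy on question sets `Fin 4`, `Fin 5` and
answer sets `Fin 3`, `Fin 3`. -/
structure Strategy (dA dB : ℕ) where
  ψ : Fin dA × Fin dB → ℂ
  P : Fin 4 → Fin 3 → Matrix (Fin dA) (Fin dA) ℂ
  Q : Fin 5 → Fin 3 → Matrix (Fin dB) (Fin dB) ℂ
  unit : ∑ p : Fin dA × Fin dB, Complex.normSq (ψ p) = 1
  P_sa : ∀ x a, (P x a)ᴴ = P x a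
  P_proj : ∀ x a, P x a * P x a = P x a
  P_complete : ∀ x, ∑ a, P x a = 1
  Q_sa : ∀ y b, (Q y b)ᴴ = Q y b
  Q_proj : ∀ y b, Q y b * Q y b = Q y b
  Q_complete : ∀ y, ∑ b, Q y b = 1

/-- Action of `P ⊗ I` on a bipartite vector. -/
def actA {dA dB : ℕ} (P : Matrix (Fin dA) (Fin dA) ℂ) (ψ : Fin dA × Fin dB → ℂ) :
    Fin dA × Fin dB → ℂ := fun p => ∑ k, P p.1 k * ψ (k, p.2)

/-- Action of `I ⊗ Q` on a bipartite vector. -/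
def actB {dA dB : ℕ} (Q : Matrix (Fin dB) (Fin dB) ℂ) (ψ : Fin dA × Fin dB → ℂ) :
    Fin dA × Fin dB → ℂ := fun p => ∑ l, Q p.2 l * ψ (p.1, l)

/-- The correlation induced by a strategy: `⟨ψ, (P_x^a ⊗ Q_y^b) ψ⟩`. -/
def induced {dA dB : ℕ} (S : Strategy dA dB) (x : Fin 4) (y : Fin 5) (a b : Fin 3) : ℂ :=
  ∑ p : Fin dA × Fin dB, (starRingEnd ℂ) (S.ψ p) * actA (S.P x a) (actB (S.Q y b) S.ψ) p

end Sep

namespace Sep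

variable {n : Type*} [Fintype n] [DecidableEq n]

theorem exists_pseudoinverse (H : Matrix n n ℂ) (hH : Hᴴ = H) :
    ∃ K : Matrix n n ℂ, Kᴴ = K ∧ H * K * H = H ∧ ∀ M, H * M = M * H → K * M = M * K := by
  have hsa : IsSelfAdjoint H := hH
  have hc (f : ℝ → ℝ) : ContinuousOn f (spectrum ℝ H) :=
    (Matrix.finite_real_spectrum (A := H)).continuousOn f
  refine ⟨cfc (fun x : ℝ => x⁻¹) H, ?_, ?_, fun M hM => ?_⟩
  · exact (cfc_predicate (R := ℝ) (fun x : ℝ => x⁻¹) H : IsSelfAdjoint _)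
  · conv_lhs =>
      enter [1, 1]
      rw [← cfc_id' ℝ H]
    conv_lhs =>
      enter [2]
      rw [← cfc_id' ℝ H]
    rw [← cfc_mul _ _ H (hc _) (hc _), ← cfc_mul _ _ H (hc _) (hc _)]
    conv_rhs => rw [← cfc_id' ℝ H]
    refine cfc_congr fun x _ => ?_
    exact mul_inv_mul_cancel x
  · exact (Commute.cfc_real (show Commute H M from hM) _).eq

/-- Regularization of the pair `(B₀ + B₁) / 2c`, `(B₀ - B₁) / 2s`, where `c² + s² = 1`, to a
projection and a unitary, modulo multiples of `(B₀ + B₁)² - 4c²`. -/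
theorem exists_regularization (B₀ B₁ : Matrix n n ℂ) (h₀ : B₀ᴴ = B₀) (h₁ : B₁ᴴ = B₁)
    (hs₀ : B₀ * B₀ = 1) (hs₁ : B₁ * B₁ = 1) {c s : ℝ} (hc : c ≠ 0) (hs : s ≠ 0)
    (hcs : c ^ 2 + s ^ 2 = 1) :
    ∃ p U L M : Matrix n n ℂ, pᴴ = p ∧ p * p = p ∧ Uᴴ * U = 1 ∧
      p = (2 : ℝ)⁻¹ • (1 + (2 * c)⁻¹ • (B₀ + B₁)) +
        L * ((B₀ + B₁) * (B₀ + B₁) - (4 * c ^ 2) • 1) ∧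
      U = (2 * s)⁻¹ • (B₀ - B₁) + M * ((B₀ + B₁) * (B₀ + B₁) - (4 * c ^ 2) • 1) := by
  set H : Matrix n n ℂ := (B₀ + B₁) * (B₀ + B₁) - (4 * c ^ 2) • 1 with hHdef
  have hH : Hᴴ = H := by
    simp [hHdef, conjTranspose_mul, conjTranspose_smul, h₀, h₁]
  obtain ⟨K, hK, hHKH, hcomm⟩ := exists_pseudoinverse H hH
  have r₀ (x : Matrix n n ℂ) : B₀ * (B₀ * x) = x := by rw [← mul_assoc, hs₀, one_mul]
  have r₁ (x : Matrix n n ℂ) : B₁ * (B₁ * x) = x := by rw [← mul_assoc, hs₁, one_mul]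
  set z : Matrix n n ℂ := (2 * c)⁻¹ • (B₀ + B₁) with hz
  set x : Matrix n n ℂ := (2 * s)⁻¹ • (B₀ - B₁) with hx
  have hHz : H * z = z * H := by
    simp only [hHdef, hz, mul_add, add_mul, mul_sub, sub_mul, smul_mul_assoc, mul_smul_comm,
      mul_assoc, mul_one, one_mul, r₀, r₁, hs₀, hs₁]
    module
  have hHx : H * x = x * H := by
    simp only [hHdef, hx, mul_add, add_mul, mul_sub, sub_mul, smul_mul_assoc, mul_smul_comm,
      mul_assoc, mul_one, one_mul, r₀, r₁, hs₀, hs₁]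
    module
  have hzz : z * z = 1 + ((4 * c ^ 2)⁻¹ : ℝ) • H := by
    simp only [hHdef, hz, smul_mul_assoc, mul_smul_comm, smul_sub, smul_smul]
    rw [inv_mul_cancel₀ (by positivity), one_smul, add_sub_cancel]
    congr 1
    field_simp
    norm_num
  have hxx : x * x = 1 - ((4 * s ^ 2)⁻¹ : ℝ) • H := by
    have e : (B₀ - B₁) * (B₀ - B₁) = (4 * s ^ 2) • (1 : Matrix n n ℂ) - H := by
      have : (4 * s ^ 2) = 4 - 4 * c ^ 2 := by linarith
      rw [this]
      simp only [hHdef, mul_add, add_mul, mul_sub, sub_mul, hs₀, hs₁]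
      module
    have : x * x = ((4 * s ^ 2)⁻¹ : ℝ) • ((B₀ - B₁) * (B₀ - B₁)) := by
      simp only [hx, smul_mul_assoc, mul_smul_comm, smul_smul]
      congr 1
      field_simp
      norm_num
    rw [this, e, smul_sub, smul_smul, inv_mul_cancel₀ (by positivity), one_smul]
  have hzs : zᴴ = z := by simp [hz, conjTranspose_smul, h₀, h₁]
  have hxs : xᴴ = x := by simp [hx, conjTranspose_smul, h₀, h₁]
  have hKH : K * H = H * K := hcomm H rfl
  have hKz : K * z = z * K := hcomm z hHz
  have hKx : K * x = x * K := hcomm x hHx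
  set E : Matrix n n ℂ := 1 - K * H with hE
  clear_value E H z x
  have hEs : Eᴴ = E := by simp [hE, conjTranspose_mul, hK, hH, hKH]
  have hEH : E * H = 0 := by rw [hE, sub_mul, one_mul, hKH, hHKH, sub_self]
  have hEE : E * E = E := by
    have : E * (K * H) = 0 := by rw [hKH, ← mul_assoc, hEH, zero_mul]
    nth_rewrite 2 [hE]
    rw [mul_sub, mul_one, this, sub_zero]
  have hEz : E * z = z * E := by
    rw [hE, sub_mul, mul_sub, one_mul, mul_one, mul_assoc, hHz, ← mul_assoc, hKz, mul_assoc]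
  have hEx : E * x = x * E := by
    rw [hE, sub_mul, mul_sub, one_mul, mul_one, mul_assoc, hHx, ← mul_assoc, hKx, mul_assoc]
  have hEzz : E * (z * z) = E := by simp [hzz, mul_add, hEH]
  have hExx : E * (x * x) = E := by simp [hxx, mul_sub, hEH]
  refine ⟨(2 : ℝ)⁻¹ • ((1 + z) * E), x * E + (1 - E), -((2 : ℝ)⁻¹ • ((1 + z) * K)),
    (1 - x) * K, ?_, ?_, ?_, ?_, ?_⟩
  · simp [conjTranspose_smul, conjTranspose_mul, hEs, hzs, add_mul, hEz]
  · have e1 : ((1 + z) * E) * ((1 + z) * E) = (2 : ℝ) • ((1 + z) * E) := by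
      have e2 : E * (1 + z) = (1 + z) * E := by rw [mul_add, add_mul, hEz, mul_one, one_mul]
      calc ((1 + z) * E) * ((1 + z) * E) = (1 + z) * (E * (1 + z)) * E := by
            simp only [mul_assoc]
        _ = (1 + z) * (1 + z) * (E * E) := by rw [e2]; simp only [mul_assoc]
        _ = E + (2 : ℝ) • (z * E) + z * z * E := by
            rw [hEE]; simp only [mul_add, add_mul, one_mul, mul_one]; module
        _ = E + (2 : ℝ) • (z * E) + E := by
            congr 1
            rw [mul_assoc, ← hEz, ← mul_assoc, ← hEz, mul_assoc, hEzz]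
        _ = (2 : ℝ) • ((1 + z) * E) := by simp only [add_mul, one_mul]; module
    rw [smul_mul_smul_comm, e1, smul_smul]
    norm_num
  · have e1 : (x * E) * (x * E) = E := by
      rw [← hEx, mul_assoc, ← mul_assoc x, ← hEx, mul_assoc, ← mul_assoc, hEE, hExx]
    have e2 : (x * E) * E = x * E := by rw [mul_assoc, hEE]
    have e3 : E * (x * E) = x * E := by rw [← mul_assoc, hEx, mul_assoc, hEE]
    simp only [conjTranspose_add, conjTranspose_sub, conjTranspose_mul, conjTranspose_one,
      hEs, hxs, hEx, add_mul, mul_add, sub_mul, mul_sub, mul_one, one_mul, e1, e2, e3, hEE]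
    abel
  · rw [hE]
    simp only [neg_mul, smul_mul_assoc, mul_assoc, mul_sub, mul_one]
    module
  · rw [hE]
    simp only [mul_assoc, mul_sub, sub_mul, mul_one, one_mul]
    abel

/-- The expectation value `⟨v, M v⟩`, as a real-linear map in `M`. -/
def expect (v : n → ℂ) : Matrix n n ℂ →ₗ[ℝ] ℂ where
  toFun M := star v ⬝ᵥ (M *ᵥ v)
  map_add' M N := by rw [add_mulVec, dotProduct_add]
  map_smul' r M := by rw [smul_mulVec, dotProduct_smul, RingHom.id_apply]

theorem expect_apply (v : n → ℂ) (M : Matrix n n ℂ) : expect v M = star v ⬝ᵥ (M *ᵥ v) := rfl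

theorem expect_conjTranspose_mul (v : n → ℂ) (M N : Matrix n n ℂ) :
    expect v (Mᴴ * N) = star (M *ᵥ v) ⬝ᵥ (N *ᵥ v) := by
  rw [expect_apply, star_mulVec, ← dotProduct_mulVec, mulVec_mulVec]

theorem expect_mul_of_mulVec_eq_zero {v : n → ℂ} (M : Matrix n n ℂ) {N : Matrix n n ℂ}
    (h : N *ᵥ v = 0) : expect v (M * N) = 0 := by
  rw [expect_apply, ← mulVec_mulVec, h, mulVec_zero, dotProduct_zero]

theorem expect_conjTranspose_mul_of_mulVec_eq_zero {v : n → ℂ} {M : Matrix n n ℂ}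
    (N : Matrix n n ℂ) (h : M *ᵥ v = 0) : expect v (Mᴴ * N) = 0 := by
  rw [expect_conjTranspose_mul, h, star_zero, zero_dotProduct]

open scoped ComplexOrder in
theorem mulVec_eq_zero_of_expect_eq_zero {v : n → ℂ} {M : Matrix n n ℂ}
    (h : expect v (Mᴴ * M) = 0) : M *ᵥ v = 0 := by
  rwa [expect_conjTranspose_mul, dotProduct_star_self_eq_zero] at h

open scoped ComplexOrder in
theorem mulVec_eq_zero_of_expect_add_eq_zero {v : n → ℂ} {M N : Matrix n n ℂ}
    (h : expect v (Mᴴ * M + Nᴴ * N) = 0) : M *ᵥ v = 0 ∧ N *ᵥ v = 0 := by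
  rw [map_add, expect_conjTranspose_mul, expect_conjTranspose_mul,
    add_eq_zero_iff_of_nonneg (dotProduct_star_self_nonneg _) (dotProduct_star_self_nonneg _),
    dotProduct_star_self_eq_zero, dotProduct_star_self_eq_zero] at h
  exact h

/-- Self-testing relations for the tilted CHSH inequality: a vector attaining the maximal value
`4c` of `β a₀ + a₀ (b₀ + b₁) + a₁ (b₀ - b₁)` satisfies the operator relations of the ideal
strategy. -/
theorem tilted_chsh_relations {v : n → ℂ} {a₀ a₁ b₀ b₁ : Matrix n n ℂ}
    (ha₀ : a₀ᴴ = a₀) (ha₁ : a₁ᴴ = a₁) (hb₀ : b₀ᴴ = b₀) (hb₁ : b₁ᴴ = b₁)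
    (sa₀ : a₀ * a₀ = 1) (sa₁ : a₁ * a₁ = 1) (sb₀ : b₀ * b₀ = 1) (sb₁ : b₁ * b₁ = 1)
    (c₀₀ : b₀ * a₀ = a₀ * b₀) (c₀₁ : b₀ * a₁ = a₁ * b₀)
    (c₁₀ : b₁ * a₀ = a₀ * b₁) (c₁₁ : b₁ * a₁ = a₁ * b₁)
    {c β : ℝ} (hcβ : 16 * c ^ 2 = 2 * β ^ 2 + 8)
    (hI : expect v (β • a₀ + a₀ * (b₀ + b₁) + a₁ * (b₀ - b₁)) = (4 * c) • expect v 1)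
    (hZ : expect v (a₀ * (b₀ + b₁)) = (2 * c) • expect v 1) :
    (b₀ + b₁) *ᵥ v = (2 * c) • (a₀ *ᵥ v) ∧
      (a₁ * (b₀ - b₁) * (1 - a₀)) *ᵥ v = (2 * c - β) • ((1 + a₀) *ᵥ v) := by
  have ra₀ (x : Matrix n n ℂ) : a₀ * (a₀ * x) = x := by rw [← mul_assoc, sa₀, one_mul]
  have ra₁ (x : Matrix n n ℂ) : a₁ * (a₁ * x) = x := by rw [← mul_assoc, sa₁, one_mul]
  have rb₀ (x : Matrix n n ℂ) : b₀ * (b₀ * x) = x := by rw [← mul_assoc, sb₀, one_mul]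
  have rb₁ (x : Matrix n n ℂ) : b₁ * (b₁ * x) = x := by rw [← mul_assoc, sb₁, one_mul]
  have d₀₀ (x : Matrix n n ℂ) : b₀ * (a₀ * x) = a₀ * (b₀ * x) := by
    rw [← mul_assoc, c₀₀, mul_assoc]
  have d₀₁ (x : Matrix n n ℂ) : b₀ * (a₁ * x) = a₁ * (b₀ * x) := by
    rw [← mul_assoc, c₀₁, mul_assoc]
  have d₁₀ (x : Matrix n n ℂ) : b₁ * (a₀ * x) = a₀ * (b₁ * x) := by
    rw [← mul_assoc, c₁₀, mul_assoc]
  have d₁₁ (x : Matrix n n ℂ) : b₁ * (a₁ * x) = a₁ * (b₁ * x) := by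
    rw [← mul_assoc, c₁₁, mul_assoc]
  obtain ⟨R, hR⟩ : ∃ R, R = β • a₀ + a₀ * (b₀ + b₁) + a₁ * (b₀ - b₁) - (4 * c) • 1 := ⟨_, rfl⟩
  obtain ⟨T, hT⟩ : ∃ T, T = β • a₁ - (a₀ * (b₀ - b₁) + a₁ * (b₀ + b₁)) := ⟨_, rfl⟩
  obtain ⟨D, hD⟩ : ∃ D, D = (b₀ + b₁) - (2 * c) • a₀ := ⟨_, rfl⟩
  have hRs : Rᴴ = R := by
    simp [hR, conjTranspose_smul, conjTranspose_mul, ha₀, ha₁, hb₀, hb₁, mul_add, mul_sub,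
      c₀₀, c₀₁, c₁₀, c₁₁]
  have hTs : Tᴴ = T := by
    simp [hT, conjTranspose_smul, conjTranspose_mul, ha₀, ha₁, hb₀, hb₁, mul_add, mul_sub,
      c₀₀, c₀₁, c₁₀, c₁₁]
  have hDs : Dᴴ = D := by
    simp [hD, conjTranspose_smul, ha₀, hb₀, hb₁]
  have hRv : expect v R = 0 := by
    rw [hR, map_sub, hI, map_smul, sub_self]
  have hSOS : Rᴴ * R + Tᴴ * T = (-(8 * c)) • R := by
    rw [hRs, hTs]
    have hβ : β * β = 8 * c ^ 2 - 4 := by linarith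
    simp only [hR, hT, mul_add, add_mul, mul_sub, sub_mul, smul_mul_assoc, mul_smul_comm,
      mul_assoc, mul_one, one_mul, ra₀, ra₁, sa₀, sa₁, sb₀, sb₁, c₀₀, c₀₁, c₁₀, c₁₁,
      d₀₀, d₀₁, d₁₀, d₁₁, smul_add, smul_sub, smul_smul, hβ]
    module
  obtain ⟨hRz, hTz⟩ : R *ᵥ v = 0 ∧ T *ᵥ v = 0 :=
    mulVec_eq_zero_of_expect_add_eq_zero (by rw [hSOS, map_smul, hRv, smul_zero])
  have hZZ : expect v ((b₀ + b₁) * (b₀ + b₁)) = (4 * c ^ 2) • expect v 1 := by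
    have e : (b₀ + b₁) * a₀ * R - Tᴴ * (a₁ * (b₀ + b₁)) =
        (2 : ℝ) • ((b₀ + b₁) * (b₀ + b₁)) - (4 * c) • (a₀ * (b₀ + b₁)) := by
      rw [hTs]
      simp only [hR, hT, mul_add, add_mul, mul_sub, sub_mul, smul_mul_assoc, mul_smul_comm,
        mul_assoc, mul_one, ra₀, ra₁, sa₀, sa₁, sb₀, sb₁, c₀₀, c₁₀,
        d₀₀, d₀₁, d₁₀, d₁₁]
      module
    have e' := congrArg (expect v) e
    rw [map_sub, expect_mul_of_mulVec_eq_zero _ hRz,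
      expect_conjTranspose_mul_of_mulVec_eq_zero _ hTz, map_sub, map_smul, map_smul, hZ] at e'
    simp only [Complex.real_smul] at e' ⊢
    push_cast at e' ⊢
    linear_combination -e' / 2
  have hDz : D *ᵥ v = 0 := by
    refine mulVec_eq_zero_of_expect_eq_zero ?_
    have e : Dᴴ * D = (b₀ + b₁) * (b₀ + b₁) - (4 * c) • (a₀ * (b₀ + b₁)) + (4 * c ^ 2) • 1 := by
      rw [hDs]
      simp only [hD, mul_add, add_mul, mul_sub, sub_mul, smul_mul_assoc, mul_smul_comm,
        sa₀, sb₀, sb₁, c₀₀, c₁₀]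
      module
    rw [e, map_add, map_sub, map_smul, map_smul, hZZ, hZ]
    module
  refine ⟨?_, ?_⟩
  · rw [hD, sub_mulVec, smul_mulVec] at hDz
    exact sub_eq_zero.mp hDz
  · have e : a₁ * (b₀ - b₁) * (1 - a₀) - (2 * c - β) • (1 + a₀) = R - a₀ * D + a₁ * T + D := by
      simp only [hR, hT, hD, mul_add, mul_sub, sub_mul, mul_smul_comm, mul_assoc, mul_one,
        ra₁, sa₀, sa₁, c₀₀, c₁₀]
      module
    rw [← sub_eq_zero, ← smul_mulVec, ← sub_mulVec, e]
    simp only [add_mulVec, sub_mulVec, ← mulVec_mulVec, hRz, hTz, hDz, mulVec_zero, sub_zero,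
      add_zero]

theorem sumB_odm_apply (O : Matrix (Fin 2) (Fin 2) ℝ) (i j : ℕ) :
    sumB (fun m => odm m O) i j = odm ((i - 1) / 2) O i j := by
  refine tsum_eq_single _ fun m hm => ?_
  simp only [odm, embed]
  refine Finset.sum_eq_zero fun r _ => Finset.sum_eq_zero fun s _ => if_neg fun h => hm ?_
  have := r.isLt
  lia

theorem sumB_odm_add_apply (O : Matrix (Fin 2) (Fin 2) ℝ) (m : ℕ) (r s : Fin 2) :
    sumB (fun m => odm m O) (2 * m + 1 + r) (2 * m + 1 + s) = O r s := by
  have : (2 * m + 1 + (r : ℕ) - 1) / 2 = m := by have := r.isLt; lia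
  rw [sumB_odm_apply, this]
  fin_cases r <;> fin_cases s <;> simp [odm, embed]

theorem sumB_odm_zero_left (O : Matrix (Fin 2) (Fin 2) ℝ) (j : ℕ) :
    sumB (fun m => odm m O) 0 j = 0 := by
  rw [sumB_odm_apply]
  simp [odm, embed]

theorem exists_of_sumB_odm_ne_zero {O : Matrix (Fin 2) (Fin 2) ℝ} {i j : ℕ}
    (h : sumB (fun m => odm m O) i j ≠ 0) :
    ∃ m, ∃ r s : Fin 2, 2 * m + 1 + (r : ℕ) = i ∧ 2 * m + 1 + (s : ℕ) = j := by
  rw [sumB_odm_apply] at h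
  simp only [odm, embed] at h
  obtain ⟨r, -, hr⟩ := Finset.exists_ne_zero_of_sum_ne_zero h
  obtain ⟨s, -, hs⟩ := Finset.exists_ne_zero_of_sum_ne_zero hr
  obtain ⟨h1, h2⟩ := (ite_ne_right_iff.mp hs).1
  exact ⟨_, r, s, h1.symm, h2.symm⟩

/-- The correlation series attached to a pair of `ℕ×ℕ` matrices. -/
def corr (α : ℝ) (F G : Matrix ℕ ℕ ℝ) : ℝ :=
  (1 - α ^ 2) * ∑' ik : ℕ × ℕ, α ^ (ik.1 + ik.2) * F ik.1 ik.2 * G ik.1 ik.2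

theorem corr_odm_odm {α : ℝ} (hα0 : 0 < α) (hα1 : α < 1) (F G : Matrix (Fin 2) (Fin 2) ℝ) :
    corr α (sumB fun m => odm m F) (sumB fun m => odm m G) =
      α ^ 2 / (1 + α ^ 2) * (F 0 0 * G 0 0 + α * (F 0 1 * G 0 1) + α * (F 1 0 * G 1 0) +
        α ^ 2 * (F 1 1 * G 1 1)) := by
  let g : ℕ × (Fin 2 × Fin 2) → ℕ × ℕ :=
    fun p => (2 * p.1 + 1 + (p.2.1 : ℕ), 2 * p.1 + 1 + (p.2.2 : ℕ))
  have hg : Function.Injective g := by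
    rintro ⟨m, r, s⟩ ⟨m', r', s'⟩ h
    simp only [g, Prod.mk.injEq] at h
    have := r.isLt
    have := r'.isLt
    have hm : m = m' := by lia
    subst hm
    refine Prod.ext rfl (Prod.ext (Fin.ext ?_) (Fin.ext ?_)) <;> simp only <;> lia
  have hα4 : α ^ 4 < 1 := pow_lt_one₀ hα0.le hα1 (by norm_num)
  have hsupp : Function.support (fun ik : ℕ × ℕ => α ^ (ik.1 + ik.2) *
      sumB (fun m => odm m F) ik.1 ik.2 * sumB (fun m => odm m G) ik.1 ik.2) ⊆ Set.range g := by
    rintro ⟨i, j⟩ h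
    obtain ⟨m, r, s, rfl, rfl⟩ := exists_of_sumB_odm_ne_zero (right_ne_zero_of_mul h)
    exact ⟨(m, r, s), rfl⟩
  have hterm (p : ℕ × (Fin 2 × Fin 2)) : α ^ ((g p).1 + (g p).2) *
      sumB (fun m => odm m F) (g p).1 (g p).2 * sumB (fun m => odm m G) (g p).1 (g p).2 =
      (α ^ 4) ^ p.1 * (α ^ (2 + (p.2.1 : ℕ) + (p.2.2 : ℕ)) *
        (F p.2.1 p.2.2 * G p.2.1 p.2.2)) := by
    simp only [g, sumB_odm_add_apply]
    ring
  have hS : Summable fun p : ℕ × (Fin 2 × Fin 2) => (α ^ 4) ^ p.1 *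
      (α ^ (2 + (p.2.1 : ℕ) + (p.2.2 : ℕ)) * (F p.2.1 p.2.2 * G p.2.1 p.2.2)) :=
    summable_mul_of_summable_norm (f := fun m : ℕ => (α ^ 4) ^ m)
      (g := fun q : Fin 2 × Fin 2 => α ^ (2 + (q.1 : ℕ) + (q.2 : ℕ)) * (F q.1 q.2 * G q.1 q.2))
      (summable_geometric_of_lt_one (by positivity) hα4).norm (Summable.of_finite)
  rw [corr, ← hg.tsum_eq hsupp]
  simp only [hterm]
  rw [hS.tsum_prod]
  simp only [tsum_mul_left]
  rw [tsum_mul_right, tsum_geometric_of_lt_one (by positivity) hα4, tsum_fintype,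
    Fintype.sum_prod_type]
  simp only [Fin.sum_univ_two, Fin.val_zero, Fin.val_one]
  have h1 : 1 - α ^ 4 ≠ 0 := by linarith
  have h2 : 1 - α ^ 2 ≠ 0 := by nlinarith
  have h3 : 1 - α ^ 4 = (1 - α ^ 2) * (1 + α ^ 2) := by ring
  rw [h3]
  field_simp
  ring

theorem corr_E00_E00 (α : ℝ) : corr α E00 E00 = 1 - α ^ 2 := by
  rw [corr, tsum_eq_single (0, 0)]
  · simp [E00]
  · rintro ⟨i, j⟩ h
    simp_all [E00]

theorem corr_E00_odm (α : ℝ) (G : Matrix (Fin 2) (Fin 2) ℝ) :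
    corr α E00 (sumB fun m => odm m G) = 0 := by
  refine mul_eq_zero_of_right _ ((tsum_congr ?_).trans tsum_zero)
  rintro ⟨i, j⟩
  by_cases h : i = 0 <;> simp [E00, h, sumB_odm_zero_left]

theorem corr_odm_E00 (α : ℝ) (F : Matrix (Fin 2) (Fin 2) ℝ) :
    corr α (sumB fun m => odm m F) E00 = 0 := by
  refine mul_eq_zero_of_right _ ((tsum_congr ?_).trans tsum_zero)
  rintro ⟨i, j⟩
  by_cases h : i = 0 <;> simp [E00, h, sumB_odm_zero_left]

/-- The ideal three-outcome measurement attached to `O` on the pairs `{2m+1, 2m+2}`. -/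
def oddMeas (O : Matrix (Fin 2) (Fin 2) ℝ) : Fin 3 → Matrix ℕ ℕ ℝ :=
  ![sumB fun m => odm m (mn O), sumB fun m => odm m (pl O), E00]

/-- The correlation of the ideal measurements attached to `F` and `G`. -/
def oddCorr (α : ℝ) (F G : Matrix (Fin 2) (Fin 2) ℝ) (a b : Fin 3) : ℝ :=
  corr α (oddMeas F a) (oddMeas G b)

theorem oddCorr_two_left (α : ℝ) (F G : Matrix (Fin 2) (Fin 2) ℝ) (b : Fin 3) :
    oddCorr α F G 2 b = if b = 2 then 1 - α ^ 2 else 0 := by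
  fin_cases b <;> simp [oddCorr, oddMeas, corr_E00_E00, corr_E00_odm]

theorem oddCorr_two_right (α : ℝ) (F G : Matrix (Fin 2) (Fin 2) ℝ) (a : Fin 3) :
    oddCorr α F G a 2 = if a = 2 then 1 - α ^ 2 else 0 := by
  fin_cases a <;> simp [oddCorr, oddMeas, corr_E00_E00, corr_odm_E00]

theorem oddCorr_signed {α : ℝ} (hα0 : 0 < α) (hα1 : α < 1) (F G : Matrix (Fin 2) (Fin 2) ℝ) :
    oddCorr α F G 1 1 - oddCorr α F G 1 0 - oddCorr α F G 0 1 + oddCorr α F G 0 0 =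
      α ^ 2 / (1 + α ^ 2) * (F 0 0 * G 0 0 + α * (F 0 1 * G 0 1) + α * (F 1 0 * G 1 0) +
        α ^ 2 * (F 1 1 * G 1 1)) := by
  simp only [oddCorr, oddMeas, cons_val_zero, cons_val_one, corr_odm_odm hα0 hα1, pl, mn]
  simp
  ring

theorem oddCorr_marginal_zero {α : ℝ} (hα0 : 0 < α) (hα1 : α < 1)
    (F G : Matrix (Fin 2) (Fin 2) ℝ) :
    ∑ b, oddCorr α F G 0 b = α ^ 2 / (1 + α ^ 2) * (mn F 0 0 + α ^ 2 * mn F 1 1) := by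
  rw [Fin.sum_univ_three, oddCorr_two_right]
  simp only [oddCorr, oddMeas, cons_val_zero, cons_val_one, corr_odm_odm hα0 hα1, pl, mn]
  simp
  ring

theorem oddCorr_marginal_one {α : ℝ} (hα0 : 0 < α) (hα1 : α < 1)
    (F G : Matrix (Fin 2) (Fin 2) ℝ) :
    ∑ b, oddCorr α F G 1 b = α ^ 2 / (1 + α ^ 2) * (pl F 0 0 + α ^ 2 * pl F 1 1) := by
  rw [Fin.sum_univ_three, oddCorr_two_right]
  simp only [oddCorr, oddMeas, cons_val_zero, cons_val_one, corr_odm_odm hα0 hα1, pl, mn]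
  simp
  ring

theorem pstar_two_two (α : ℝ) : pstar α 2 2 = oddCorr α sz (saz α) := rfl

theorem pstar_two_three (α : ℝ) : pstar α 2 3 = oddCorr α sz (sax α) := rfl

theorem pstar_three_two (α : ℝ) : pstar α 3 2 = oddCorr α sx (saz α) := rfl

theorem pstar_three_three (α : ℝ) : pstar α 3 3 = oddCorr α sx (sax α) := rfl

theorem sin_mu (α : ℝ) : Real.sin (mu α) = Real.cos (mu α) * (2 * α / (1 + α ^ 2)) := by
  have h : Real.tan (mu α) = 2 * α / (1 + α ^ 2) := by
    rw [mu, Real.tan_arctan, Real.sin_two_mul, Real.sin_arctan, Real.cos_arctan]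
    have := Real.sq_sqrt (show (0 : ℝ) ≤ 1 + α ^ 2 by positivity)
    have h0 : √(1 + α ^ 2) ≠ 0 := by positivity
    field_simp
    rw [this]
  rw [← h, mul_comm]
  exact (Real.tan_mul_cos (Real.cos_arctan_pos _).ne').symm

variable {m : Type*} [Fintype m] [DecidableEq m]

/-- The embedding `A ↦ A ⊗ I`. -/
def tensorLeft (n m : Type*) [Fintype n] [DecidableEq n] [Fintype m] [DecidableEq m] :
    Matrix n n ℂ →ₐ[ℝ] Matrix (n × m) (n × m) ℂ where
  toFun A := A ⊗ₖ 1
  map_one' := one_kronecker_one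
  map_mul' A B := by rw [← mul_kronecker_mul, one_mul]
  map_zero' := zero_kronecker _
  map_add' A B := add_kronecker _ _ _
  commutes' r := by
    rw [Algebra.algebraMap_eq_smul_one, Algebra.algebraMap_eq_smul_one, smul_kronecker,
      one_kronecker_one]

/-- The embedding `B ↦ I ⊗ B`. -/
def tensorRight (n m : Type*) [Fintype n] [DecidableEq n] [Fintype m] [DecidableEq m] :
    Matrix m m ℂ →ₐ[ℝ] Matrix (n × m) (n × m) ℂ where
  toFun B := 1 ⊗ₖ B
  map_one' := one_kronecker_one
  map_mul' A B := by rw [← mul_kronecker_mul, one_mul]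
  map_zero' := kronecker_zero _
  map_add' A B := kronecker_add _ _ _
  commutes' r := by
    rw [Algebra.algebraMap_eq_smul_one, Algebra.algebraMap_eq_smul_one, kronecker_smul,
      one_kronecker_one]

theorem tensorLeft_mul_tensorRight (A : Matrix n n ℂ) (B : Matrix m m ℂ) :
    tensorLeft n m A * tensorRight n m B = A ⊗ₖ B := by
  change (A ⊗ₖ 1) * (1 ⊗ₖ B) = _
  rw [← mul_kronecker_mul, one_mul, mul_one]

theorem tensorRight_mul_tensorLeft (A : Matrix n n ℂ) (B : Matrix m m ℂ) :
    tensorRight n m B * tensorLeft n m A = tensorLeft n m A * tensorRight n m B := by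
  rw [tensorLeft_mul_tensorRight]
  change (1 ⊗ₖ B) * (A ⊗ₖ 1) = _
  rw [← mul_kronecker_mul, one_mul, mul_one]

theorem conjTranspose_tensorLeft (A : Matrix n n ℂ) :
    (tensorLeft n m A)ᴴ = tensorLeft n m Aᴴ := by
  change (A ⊗ₖ 1)ᴴ = Aᴴ ⊗ₖ 1
  rw [conjTranspose_kronecker, conjTranspose_one]

theorem conjTranspose_tensorRight (B : Matrix m m ℂ) :
    (tensorRight n m B)ᴴ = tensorRight n m Bᴴ := by
  change (1 ⊗ₖ B)ᴴ = 1 ⊗ₖ Bᴴ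
  rw [conjTranspose_kronecker, conjTranspose_one]

theorem actA_eq {dA dB : ℕ} (P : Matrix (Fin dA) (Fin dA) ℂ) (v : Fin dA × Fin dB → ℂ) :
    actA P v = tensorLeft (Fin dA) (Fin dB) P *ᵥ v := by
  ext ⟨i, j⟩
  change _ = ((P ⊗ₖ 1) *ᵥ v) (i, j)
  simp [actA, mulVec, dotProduct, Fintype.sum_prod_type, one_apply]

theorem actB_eq {dA dB : ℕ} (Q : Matrix (Fin dB) (Fin dB) ℂ) (v : Fin dA × Fin dB → ℂ) :
    actB Q v = tensorRight (Fin dA) (Fin dB) Q *ᵥ v := by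
  ext ⟨i, j⟩
  change _ = ((1 ⊗ₖ Q) *ᵥ v) (i, j)
  simp [actB, mulVec, dotProduct, Fintype.sum_prod_type, one_apply]

theorem induced_eq {dA dB : ℕ} (S : Strategy dA dB) (x : Fin 4) (y : Fin 5) (a b : Fin 3) :
    induced S x y a b = expect S.ψ (tensorLeft _ _ (S.P x a) * tensorRight _ _ (S.Q y b)) := by
  rw [induced, actA_eq, actB_eq, mulVec_mulVec]
  rfl

theorem sum_sum_mul_mul_eq {dA dB kA kB : ℕ} (A : Matrix (Fin kA) (Fin dA) ℂ)
    (B : Matrix (Fin kB) (Fin dB) ℂ) (v : Fin dA × Fin dB → ℂ) (k : Fin kA) (l : Fin kB) :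
    ∑ i, ∑ j, A k i * B l j * v (i, j) = ((A ⊗ₖ B) *ᵥ v) (k, l) := by
  simp [mulVec, dotProduct, Fintype.sum_prod_type]

theorem expect_one (v : n → ℂ) : expect v 1 = ((∑ i, Complex.normSq (v i) : ℝ) : ℂ) := by
  rw [expect_apply, one_mulVec]
  simp [dotProduct, Complex.normSq_eq_conj_mul_self]

theorem mul_eq_zero_of_measurement {P : Fin 3 → Matrix n n ℂ} (hP : ∀ a, P a * P a = P a)
    (hsum : ∑ a, P a = 1) {a b : Fin 3} (hab : a ≠ b) : P a * P b = 0 := by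
  have key (c : Fin 3) (h : P a + P b = 1 - P c) : P a * P b = 0 := by
    have h1 : (P a + P b) * (P a + P b) = P a + P b := by
      rw [h, mul_sub, sub_mul, sub_mul, hP]
      simp
    have h2 : P a * P b + P b * P a = 0 := by
      simp only [mul_add, add_mul, hP] at h1
      have : P a * P b + P b * P a = P a + P b * P a + (P a * P b + P b) - (P a + P b) := by abel
      rw [this, h1, sub_self]
    have h3 : P a * P b = -(P a * P b * P a) := by
      have := congrArg (P a * ·) h2
      simp only [mul_add, mul_zero, ← mul_assoc, hP] at this
      exact eq_neg_of_add_eq_zero_left this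
    have h4 : P a * P b * P a = 0 := by
      have := congrArg (· * P a) h3
      simp only [neg_mul, mul_assoc, hP] at this
      rw [mul_assoc]
      have h5 : (2 : ℝ) • (P a * (P b * P a)) = 0 := by
        rw [two_smul]
        exact add_eq_zero_iff_eq_neg.mpr this
      exact (smul_eq_zero.mp h5).resolve_left two_ne_zero
    rw [h3, h4, neg_zero]
  rw [Fin.sum_univ_three] at hsum
  have e (c : Fin 3) (h : P a + P b + P c = P 0 + P 1 + P 2) : P a * P b = 0 :=
    key c (by rw [← hsum, ← h]; abel)
  fin_cases a <;> fin_cases b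
  · exact absurd rfl hab
  · exact e 2 rfl
  · exact e 1 (by simp only [Fin.reduceFinMk, Fin.zero_eta]; abel)
  · exact e 2 (by simp only [Fin.zero_eta, Fin.mk_one]; abel)
  · exact absurd rfl hab
  · exact e 0 (by simp only [Fin.reduceFinMk, Fin.mk_one]; abel)
  · exact e 1 (by simp only [Fin.reduceFinMk, Fin.zero_eta]; abel)
  · exact e 0 (by simp only [Fin.reduceFinMk, Fin.mk_one]; abel)
  · exact absurd rfl hab

theorem mulVec_eq_mulVec_of_expect_eq {v : n → ℂ} {e f : Matrix n n ℂ} (he : eᴴ = e)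
    (hf : fᴴ = f) (hee : e * e = e) (hff : f * f = f) (hfe : f * e = e * f) {r : ℂ}
    (h₁ : expect v e = r) (h₂ : expect v f = r) (h₃ : expect v (e * f) = r) :
    e *ᵥ v = f *ᵥ v := by
  rw [← sub_eq_zero, ← sub_mulVec]
  refine mulVec_eq_zero_of_expect_eq_zero ?_
  rw [conjTranspose_sub, he, hf, mul_sub, sub_mul, sub_mul, hee, hff, hfe, map_sub, map_sub,
    map_sub, h₁, h₂, h₃]
  ring

theorem expect_mulVec {v w : n → ℂ} {E F : Matrix n n ℂ} (h₁ : w = E *ᵥ v) (h₂ : w = F *ᵥ v)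
    (M : Matrix n n ℂ) : expect w M = expect v (Eᴴ * M * F) := by
  rw [mul_assoc, expect_conjTranspose_mul, ← mulVec_mulVec, ← h₁, ← h₂, expect_apply]

theorem one_sub_mul_one_sub_two_smul {P : Fin 3 → Matrix n n ℂ} (hP : ∀ a, P a * P a = P a)
    (hsum : ∑ a, P a = 1) : (1 - P 2) * (1 - (2 : ℝ) • P 0) = P 1 - P 0 ∧
      (1 - (2 : ℝ) • P 0) * (1 - P 2) = P 1 - P 0 := by
  have h₁ := mul_eq_zero_of_measurement hP hsum (show (2 : Fin 3) ≠ 0 by decide)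
  have h₂ := mul_eq_zero_of_measurement hP hsum (show (0 : Fin 3) ≠ 2 by decide)
  have h₃ : P 1 = 1 - P 0 - P 2 := by
    rw [← hsum, Fin.sum_univ_three]
    abel
  constructor
  · simp only [mul_sub, sub_mul, mul_smul_comm, h₁, h₃, mul_one, one_mul]
    module
  · simp only [mul_sub, sub_mul, smul_mul_assoc, h₂, h₃, mul_one, one_mul]
    module

theorem one_sub_two_smul_involutive {p : Matrix n n ℂ} (hp : p * p = p) :
    (1 - (2 : ℝ) • p) * (1 - (2 : ℝ) • p) = 1 := by
  simp only [mul_sub, sub_mul, smul_mul_assoc, mul_smul_comm, hp, mul_one, one_mul]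
  module

theorem conjTranspose_one_sub_two_smul {ι : Type*} [DecidableEq ι] {p : Matrix ι ι ℂ}
    (hp : pᴴ = p) :
    (1 - (2 : ℝ) • p)ᴴ = 1 - (2 : ℝ) • p := by
  rw [conjTranspose_sub, conjTranspose_one, conjTranspose_smul, hp, star_trivial]

/-- The relations satisfied by the third question pair of a strategy inducing the ideal
correlation: a projection and a unitary on Bob's side which, together with Alice's measurements,
transform the three components `P_2^a ψ` as in the ideal strategy. -/
theorem Strategy.exists_extraction {α : ℝ} (hα0 : 0 < α) (hα1 : α < 1) {dA dB : ℕ}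
    (S : Strategy dA dB) (hind : ∀ x y a b, induced S x y a b = (pstar α x y a b : ℂ)) :
    ∃ p U : Matrix (Fin dB) (Fin dB) ℂ, pᴴ = p ∧ p * p = p ∧ Uᴴ * U = 1 ∧
      tensorRight (Fin dA) (Fin dB) p *ᵥ actA (S.P 2 1) S.ψ = actA (S.P 2 1) S.ψ ∧
      tensorRight (Fin dA) (Fin dB) p *ᵥ actA (S.P 2 0) S.ψ = 0 ∧
      (tensorLeft (Fin dA) (Fin dB) (1 - (2 : ℝ) • S.P 3 0) *
        tensorRight (Fin dA) (Fin dB) U) *ᵥ actA (S.P 2 0) S.ψ = α • actA (S.P 2 1) S.ψ ∧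
      tensorRight (Fin dA) (Fin dB) (S.Q 2 2) *ᵥ S.ψ = actA (S.P 2 2) S.ψ ∧
      (∑ i, Complex.normSq (actA (S.P 2 1) S.ψ i) = α ^ 2 / (1 + α ^ 2)) ∧
      ∑ i, Complex.normSq (actA (S.P 2 2) S.ψ i) = 1 - α ^ 2 := by
  simp only [actA_eq]
  set ψ := S.ψ with hψ
  obtain ⟨P, hP⟩ : ∃ P, P = fun x a => tensorLeft (Fin dA) (Fin dB) (S.P x a) := ⟨_, rfl⟩
  obtain ⟨Q, hQ⟩ : ∃ Q, Q = fun y b => tensorRight (Fin dA) (Fin dB) (S.Q y b) := ⟨_, rfl⟩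
  have hPs (x a) : (P x a)ᴴ = P x a := by simp only [hP, conjTranspose_tensorLeft, S.P_sa]
  have hQs (x a) : (Q x a)ᴴ = Q x a := by simp only [hQ, conjTranspose_tensorRight, S.Q_sa]
  have hPP (x a) : P x a * P x a = P x a := by simp only [hP, ← map_mul, S.P_proj]
  have hQQ (x a) : Q x a * Q x a = Q x a := by simp only [hQ, ← map_mul, S.Q_proj]
  have hP1 (x) : ∑ a, P x a = 1 := by simp only [hP, ← map_sum, S.P_complete, map_one]
  have hQ1 (x) : ∑ a, Q x a = 1 := by simp only [hQ, ← map_sum, S.Q_complete, map_one]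
  have hQP (x y a b) : Q y b * P x a = P x a * Q y b := by
    simp only [hP, hQ, tensorRight_mul_tensorLeft]
  have hPQ (x y a b) : expect ψ (P x a * Q y b) = (pstar α x y a b : ℂ) := by
    rw [← hind, induced_eq, hP, hQ]
  have hPe (x a y) : expect ψ (P x a) = ((∑ b, pstar α x y a b : ℝ) : ℂ) := by
    rw [Complex.ofReal_sum, ← Finset.sum_congr rfl fun b _ => hPQ x y a b, ← map_sum,
      ← Finset.mul_sum, hQ1, mul_one]
  have hQe (y b x) : expect ψ (Q y b) = ((∑ a, pstar α x y a b : ℝ) : ℂ) := by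
    rw [Complex.ofReal_sum, ← Finset.sum_congr rfl fun a _ => hPQ x y a b, ← map_sum,
      ← Finset.sum_mul, hP1, one_mul]
  have htwo (x : Fin 4) (y : Fin 5) (F G : Matrix (Fin 2) (Fin 2) ℝ)
      (h : pstar α x y = oddCorr α F G) : P x 2 *ᵥ ψ = Q y 2 *ᵥ ψ := by
    refine mulVec_eq_mulVec_of_expect_eq (hPs _ _) (hQs _ _) (hPP _ _) (hQQ _ _) (hQP _ _ _ _)
      (r := ((1 - α ^ 2 : ℝ) : ℂ)) ?_ ?_ ?_
    · rw [hPe x 2 y, h]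
      simp [oddCorr_two_left]
    · rw [hQe y 2 x, h]
      simp [oddCorr_two_right]
    · rw [hPQ, h, oddCorr_two_left, if_pos rfl]
  have t₂₂ := htwo 2 2 _ _ (pstar_two_two α)
  have t₂₃ := htwo 2 3 _ _ (pstar_two_three α)
  have t₃₂ := htwo 3 2 _ _ (pstar_three_two α)
  obtain ⟨v, hv⟩ : ∃ v, v = (1 - P 2 2) *ᵥ ψ := ⟨_, rfl⟩
  have hvP (x : Fin 4) (h : P x 2 *ᵥ ψ = P 2 2 *ᵥ ψ) : v = (1 - P x 2) *ᵥ ψ := by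
    rw [hv, sub_mulVec, sub_mulVec, h]
  have hvQ (y : Fin 5) (h : P 2 2 *ᵥ ψ = Q y 2 *ᵥ ψ) : v = (1 - Q y 2) *ᵥ ψ := by
    rw [hv, sub_mulVec, sub_mulVec, h]
  have hv₃ : v = (1 - P 3 2) *ᵥ ψ := hvP 3 (t₃₂.trans t₂₂.symm)
  have hsigned (x : Fin 4) (y : Fin 5) (F G : Matrix (Fin 2) (Fin 2) ℝ)
      (h : pstar α x y = oddCorr α F G) (hx : v = (1 - P x 2) *ᵥ ψ) (hy : v = (1 - Q y 2) *ᵥ ψ) :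
      expect v ((1 - (2 : ℝ) • P x 0) * (1 - (2 : ℝ) • Q y 0)) = ((α ^ 2 / (1 + α ^ 2) *
        (F 0 0 * G 0 0 + α * (F 0 1 * G 0 1) + α * (F 1 0 * G 1 0) +
          α ^ 2 * (F 1 1 * G 1 1)) : ℝ) : ℂ) := by
    rw [← oddCorr_signed hα0 hα1, ← h, expect_mulVec hx hy, conjTranspose_sub,
      conjTranspose_one, hPs, ← mul_assoc,
      (one_sub_mul_one_sub_two_smul (hPP x) (hP1 x)).1, mul_assoc,
      (one_sub_mul_one_sub_two_smul (hQQ y) (hQ1 y)).2]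
    simp only [mul_sub, sub_mul, map_sub, hPQ]
    push_cast
    ring
  have hd : 1 + α ^ 2 ≠ 0 := by positivity
  have e2 : expect ψ (P 2 2) = ((1 - α ^ 2 : ℝ) : ℂ) := by
    rw [hPe 2 2 2, pstar_two_two]
    simp [oddCorr_two_left]
  have e1 : expect ψ (P 2 1) = ((α ^ 2 / (1 + α ^ 2) : ℝ) : ℂ) := by
    rw [hPe 2 1 2, pstar_two_two, oddCorr_marginal_one hα0 hα1]
    congr 1
    simp [pl, sz]
    norm_num
  have e0 : expect ψ (P 2 0) = ((α ^ 4 / (1 + α ^ 2) : ℝ) : ℂ) := by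
    rw [hPe 2 0 2, pstar_two_two, oddCorr_marginal_zero hα0 hα1]
    congr 1
    simp [mn, sz]
    field_simp
    norm_num
  have hψ1 : expect ψ 1 = ((1 : ℝ) : ℂ) := by rw [expect_one, hψ, S.unit]
  have hN : expect v 1 = ((α ^ 2 : ℝ) : ℂ) := by
    rw [expect_mulVec hv hv, mul_one, conjTranspose_sub, conjTranspose_one, hPs]
    simp only [mul_sub, sub_mul, hPP, mul_one, one_mul, sub_self, sub_zero, map_sub, hψ1, e2]
    push_cast
    ring
  have hA : expect v (1 - (2 : ℝ) • P 2 0) =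
      ((α ^ 2 * (1 - α ^ 2) / (1 + α ^ 2) : ℝ) : ℂ) := by
    have h0 := mul_eq_zero_of_measurement (hPP 2) (hP1 2) (show (0 : Fin 3) ≠ 2 by decide)
    have h1 := mul_eq_zero_of_measurement (hPP 2) (hP1 2) (show (1 : Fin 3) ≠ 2 by decide)
    rw [expect_mulVec hv hv, conjTranspose_sub, conjTranspose_one, hPs,
      (one_sub_mul_one_sub_two_smul (hPP 2) (hP1 2)).1, mul_sub, mul_one, sub_mul, h0, h1,
      sub_zero, sub_zero, map_sub, e0, e1, ← Complex.ofReal_sub]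
    congr 1
    ring
  obtain ⟨c, hc⟩ : ∃ c, c = Real.cos (mu α) := ⟨_, rfl⟩
  obtain ⟨s, hs⟩ : ∃ s, s = Real.sin (mu α) := ⟨_, rfl⟩
  have hsc : s = c * (2 * α / (1 + α ^ 2)) := by rw [hs, hc, sin_mu]
  have hcs : c ^ 2 + s ^ 2 = 1 := by rw [hs, hc, Real.cos_sq_add_sin_sq]
  have hcpos : 0 < c := hc ▸ Real.cos_arctan_pos _
  have hspos : 0 < s := by rw [hsc]; positivity
  have c₂₂ := hsigned 2 2 _ _ (pstar_two_two α) hv (hvQ 2 t₂₂)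
  have c₂₃ := hsigned 2 3 _ _ (pstar_two_three α) hv (hvQ 3 t₂₃)
  have c₃₂ := hsigned 3 2 _ _ (pstar_three_two α) hv₃ (hvQ 2 t₂₂)
  have c₃₃ := hsigned 3 3 _ _ (pstar_three_three α) hv₃ (hvQ 3 t₂₃)
  simp only [sz, sx, saz, sax, ← hc, ← hs, Matrix.add_apply, Matrix.sub_apply,
    Matrix.smul_apply, of_apply, cons_val', cons_val_zero, cons_val_one, cons_val_fin_one,
    smul_eq_mul] at c₂₂ c₂₃ c₃₂ c₃₃
  obtain ⟨β, hβ⟩ : ∃ β, β = 2 * c * (1 - α ^ 2) / (1 + α ^ 2) := ⟨_, rfl⟩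
  have hcβ : 16 * c ^ 2 = 2 * β ^ 2 + 8 := by
    rw [hsc] at hcs
    rw [hβ]
    field_simp at hcs ⊢
    linear_combination 8 * hcs
  obtain ⟨hZ, hX⟩ := tilted_chsh_relations (v := v) (c := c) (β := β)
    (conjTranspose_one_sub_two_smul (hPs 2 0)) (conjTranspose_one_sub_two_smul (hPs 3 0))
    (conjTranspose_one_sub_two_smul (hQs 2 0)) (conjTranspose_one_sub_two_smul (hQs 3 0))
    (one_sub_two_smul_involutive (hPP 2 0)) (one_sub_two_smul_involutive (hPP 3 0))
    (one_sub_two_smul_involutive (hQQ 2 0)) (one_sub_two_smul_involutive (hQQ 3 0))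
    (by simp only [mul_sub, sub_mul, smul_mul_assoc, mul_smul_comm, hQP, mul_one, one_mul]; module)
    (by simp only [mul_sub, sub_mul, smul_mul_assoc, mul_smul_comm, hQP, mul_one, one_mul]; module)
    (by simp only [mul_sub, sub_mul, smul_mul_assoc, mul_smul_comm, hQP, mul_one, one_mul]; module)
    (by simp only [mul_sub, sub_mul, smul_mul_assoc, mul_smul_comm, hQP, mul_one, one_mul]; module)
    hcβ
    (by
      rw [mul_add (1 - (2 : ℝ) • P 2 0),
        mul_sub (1 - (2 : ℝ) • P 3 0) (1 - (2 : ℝ) • Q 2 0) (1 - (2 : ℝ) • Q 3 0),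
        map_add, map_add, map_add, map_sub, map_smul, c₂₂, c₂₃, c₃₂, c₃₃, hA,
        hN, Complex.real_smul, Complex.real_smul]
      simp only [← Complex.ofReal_add, ← Complex.ofReal_sub, ← Complex.ofReal_mul]
      congr 1
      rw [hβ, hsc]
      field_simp
      ring)
    (by
      rw [mul_add (1 - (2 : ℝ) • P 2 0), map_add, c₂₂, c₂₃, hN, Complex.real_smul]
      simp only [← Complex.ofReal_add, ← Complex.ofReal_mul]
      congr 1
      field_simp
      ring)
  have hv' : v = P 2 0 *ᵥ ψ + P 2 1 *ᵥ ψ := by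
    rw [hv, ← hP1 2, Fin.sum_univ_three, add_sub_cancel_right, add_mulVec]
  have hPv (a : Fin 3) (ha : a ≠ 2) : P 2 a *ᵥ v = P 2 a *ᵥ ψ := by
    rw [hv, mulVec_mulVec, mul_sub, mul_one, mul_eq_zero_of_measurement (hPP 2) (hP1 2) ha,
      sub_zero]
  have hP0v := hPv 0 (by decide)
  have hP1v := hPv 1 (by decide)
  have hAv : (1 - (2 : ℝ) • P 2 0) *ᵥ v = v - (2 : ℝ) • (P 2 0 *ᵥ ψ) := by
    rw [sub_mulVec, one_mulVec, smul_mulVec, hP0v]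
  obtain ⟨p, U, L, M, hps, hpp, hUU, hpeq, hUeq⟩ := exists_regularization
    (1 - (2 : ℝ) • S.Q 2 0) (1 - (2 : ℝ) • S.Q 3 0)
    (conjTranspose_one_sub_two_smul (S.Q_sa 2 0)) (conjTranspose_one_sub_two_smul (S.Q_sa 3 0))
    (one_sub_two_smul_involutive (S.Q_proj 2 0)) (one_sub_two_smul_involutive (S.Q_proj 3 0))
    hcpos.ne' hspos.ne' hcs
  have hH : ((1 - (2 : ℝ) • Q 2 0 + (1 - (2 : ℝ) • Q 3 0)) *
      (1 - (2 : ℝ) • Q 2 0 + (1 - (2 : ℝ) • Q 3 0)) - (4 * c ^ 2) • 1) *ᵥ v = 0 := by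
    have hcom : (1 - (2 : ℝ) • Q 2 0 + (1 - (2 : ℝ) • Q 3 0)) * (1 - (2 : ℝ) • P 2 0) =
        (1 - (2 : ℝ) • P 2 0) * (1 - (2 : ℝ) • Q 2 0 + (1 - (2 : ℝ) • Q 3 0)) := by
      simp only [mul_sub, sub_mul, mul_add, add_mul, smul_mul_assoc, mul_smul_comm, hQP, mul_one,
        one_mul]
      module
    rw [sub_mulVec, ← mulVec_mulVec, hZ, mulVec_smul, mulVec_mulVec, hcom, ← mulVec_mulVec, hZ,
      mulVec_smul, mulVec_mulVec, one_sub_two_smul_involutive (hPP 2 0), smul_mulVec, smul_smul,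
      ← sub_smul]
    ring_nf
    exact zero_smul _ _
  have hpv : tensorRight (Fin dA) (Fin dB) p *ᵥ v = P 2 1 *ᵥ ψ := by
    rw [hpeq]
    simp only [map_add, map_sub, map_mul, map_smul, map_one]
    simp only [hQ] at hH hZ
    rw [add_mulVec, ← mulVec_mulVec, hH, mulVec_zero, add_zero, smul_mulVec, add_mulVec,
      smul_mulVec, hZ, hAv, one_mulVec, smul_smul, inv_mul_cancel₀ (by positivity), one_smul, hv']
    module
  have hUv : tensorRight (Fin dA) (Fin dB) U *ᵥ v =
      (2 * s)⁻¹ • ((1 - (2 : ℝ) • Q 2 0 - (1 - (2 : ℝ) • Q 3 0)) *ᵥ v) := by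
    rw [hUeq]
    simp only [map_add, map_sub, map_mul, map_smul, map_one]
    simp only [hQ] at hH ⊢
    rw [add_mulVec, ← mulVec_mulVec, hH, mulVec_zero, add_zero, smul_mulVec]
  have hPdef (x a) : tensorLeft (Fin dA) (Fin dB) (S.P x a) = P x a := by rw [hP]
  have hQdef (y b) : tensorRight (Fin dA) (Fin dB) (S.Q y b) = Q y b := by rw [hQ]
  have hright (B : Matrix (Fin dB) (Fin dB) ℂ) (a : Fin 3) :
      tensorRight (Fin dA) (Fin dB) B * P 2 a = P 2 a * tensorRight (Fin dA) (Fin dB) B := by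
    rw [hP, tensorRight_mul_tensorLeft]
  refine ⟨p, U, hps, hpp, hUU, ?_, ?_, ?_, ?_, ?_, ?_⟩
  all_goals simp only [hPdef, hQdef]
  · conv_lhs => rw [← hP1v, mulVec_mulVec, hright, ← mulVec_mulVec, hpv, mulVec_mulVec, hPP]
  · rw [← hP0v, mulVec_mulVec, hright, ← mulVec_mulVec, hpv, mulVec_mulVec,
      mul_eq_zero_of_measurement (hPP 2) (hP1 2) (show (0 : Fin 3) ≠ 1 by decide), zero_mulVec]
  · have hP0 : P 2 0 = (2 : ℝ)⁻¹ • (1 - (1 - (2 : ℝ) • P 2 0)) := by module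
    have ha₁ : tensorLeft (Fin dA) (Fin dB) (1 - (2 : ℝ) • S.P 3 0) = 1 - (2 : ℝ) • P 3 0 := by
      rw [map_sub, map_smul, map_one, hPdef]
    have hQP₀ : (1 - (2 : ℝ) • Q 2 0 - (1 - (2 : ℝ) • Q 3 0)) * P 2 0 =
        P 2 0 * (1 - (2 : ℝ) • Q 2 0 - (1 - (2 : ℝ) • Q 3 0)) := by
      simp only [mul_sub, sub_mul, smul_mul_assoc, mul_smul_comm, hQP, mul_one, one_mul]
    have hcoef : 2 * c - β = 2 * s * α := by
      rw [hβ, hsc]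
      field_simp
      ring
    rw [← hP0v, ← mulVec_mulVec, mulVec_mulVec v, hright, ← mulVec_mulVec, hUv, mulVec_smul,
      mulVec_smul, mulVec_mulVec v (P 2 0), ← hQP₀, hP0, mulVec_mulVec, ← mul_assoc, mul_smul_comm,
      smul_mulVec, ha₁, hX, hcoef, add_mulVec, one_mulVec, hAv, hv']
    simp only [smul_smul, smul_add, smul_sub]
    match_scalars <;> field_simp <;> ring
  · exact t₂₂.symm
  · apply Complex.ofReal_injective
    rw [← expect_one, expect_mulVec rfl rfl, hPs, mul_one, hPP, e1]
  · apply Complex.ofReal_injective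
    rw [← expect_one, expect_mulVec rfl rfl, hPs, mul_one, hPP, e2]

theorem conjTranspose_mul_self_of_sum {d : ℕ} {L : Fin 3 → Matrix (Fin d) (Fin d) ℂ}
    (h : ∑ s, (L s)ᴴ * L s = 1) :
    (of fun (sk : Fin 3 × Fin d) i => L sk.1 sk.2 i)ᴴ *
      (of fun (sk : Fin 3 × Fin d) i => L sk.1 sk.2 i) = 1 := by
  ext i j
  rw [← h]
  simp [mul_apply, Fintype.sum_prod_type, Matrix.sum_apply]

/-- Alice's extraction map, blockwise. -/
def extractA {d : ℕ} (R : Matrix (Fin d) (Fin d) ℂ) (P : Fin 3 → Matrix (Fin d) (Fin d) ℂ) :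
    Fin 3 → Matrix (Fin d) (Fin d) ℂ :=
  ![R * P 0, P 1, P 2]

/-- Bob's extraction map, blockwise. -/
def extractB {d : ℕ} (U p q : Matrix (Fin d) (Fin d) ℂ) : Fin 3 → Matrix (Fin d) (Fin d) ℂ :=
  ![U * (1 - p) * (1 - q), p * (1 - q), q]

theorem sum_conjTranspose_mul_extractA {d : ℕ} {R : Matrix (Fin d) (Fin d) ℂ}
    {P : Fin 3 → Matrix (Fin d) (Fin d) ℂ} (hR : Rᴴ * R = 1) (hPs : ∀ a, (P a)ᴴ = P a)
    (hP : ∀ a, P a * P a = P a) (hsum : ∑ a, P a = 1) :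
    ∑ s, (extractA R P s)ᴴ * extractA R P s = 1 := by
  rw [← hsum, Fin.sum_univ_three, Fin.sum_univ_three]
  simp only [extractA, cons_val, conjTranspose_mul, hPs, hP]
  rw [mul_assoc, ← mul_assoc Rᴴ, hR, one_mul, hP]

theorem sum_conjTranspose_mul_extractB {d : ℕ} {U p q : Matrix (Fin d) (Fin d) ℂ}
    (hU : Uᴴ * U = 1) (hps : pᴴ = p) (hp : p * p = p) (hqs : qᴴ = q) (hq : q * q = q) :
    ∑ s, (extractB U p q s)ᴴ * extractB U p q s = 1 := by
  have h₁ : (1 - p)ᴴ = 1 - p := by rw [conjTranspose_sub, conjTranspose_one, hps]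
  have h₂ : (1 - q)ᴴ = 1 - q := by rw [conjTranspose_sub, conjTranspose_one, hqs]
  have h₃ : (1 - p) * (1 - p) = 1 - p := by simp [mul_sub, sub_mul, hp]
  have h₄ : (1 - q) * (1 - q) = 1 - q := by simp [mul_sub, sub_mul, hq]
  rw [Fin.sum_univ_three]
  simp only [extractB, cons_val, conjTranspose_mul, h₁, h₂, hps, hqs, hq]
  calc (1 - q) * ((1 - p) * Uᴴ) * (U * (1 - p) * (1 - q)) + (1 - q) * p * (p * (1 - q)) + q
      = (1 - q) * ((1 - p) * (Uᴴ * U) * (1 - p) + p * p) * (1 - q) + q := by noncomm_ring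
    _ = 1 := by rw [hU, mul_one, h₃, hp, sub_add_cancel, mul_one, h₄, sub_add_cancel]

/-- The joint action of the extraction maps on the three components of the state. -/
theorem Strategy.exists_extraction_maps {α : ℝ} (hα0 : 0 < α) (hα1 : α < 1) {dA dB : ℕ}
    (S : Strategy dA dB) (hind : ∀ x y a b, induced S x y a b = (pstar α x y a b : ℂ)) :
    ∃ (A : Fin 3 → Matrix (Fin dA) (Fin dA) ℂ) (B : Fin 3 → Matrix (Fin dB) (Fin dB) ℂ),
      ∑ s, (A s)ᴴ * A s = 1 ∧ ∑ s, (B s)ᴴ * B s = 1 ∧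
      (∀ s t, (A s ⊗ₖ B t) *ᵥ actA (S.P 2 0) S.ψ =
        if s = 0 ∧ t = 0 then α • actA (S.P 2 1) S.ψ else 0) ∧
      (∀ s t, (A s ⊗ₖ B t) *ᵥ actA (S.P 2 1) S.ψ =
        if s = 1 ∧ t = 1 then actA (S.P 2 1) S.ψ else 0) ∧
      (∀ s t, (A s ⊗ₖ B t) *ᵥ actA (S.P 2 2) S.ψ =
        if s = 2 ∧ t = 2 then actA (S.P 2 2) S.ψ else 0) ∧
      (∑ i, Complex.normSq (actA (S.P 2 1) S.ψ i) = α ^ 2 / (1 + α ^ 2)) ∧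
      ∑ i, Complex.normSq (actA (S.P 2 2) S.ψ i) = 1 - α ^ 2 := by
  obtain ⟨p, U, hps, hpp, hUU, hp1, hp0, hU, hq, n1, n2⟩ := S.exists_extraction hα0 hα1 hind
  have hR : (1 - (2 : ℝ) • S.P 3 0)ᴴ * (1 - (2 : ℝ) • S.P 3 0) = 1 := by
    rw [conjTranspose_one_sub_two_smul (S.P_sa 3 0), one_sub_two_smul_involutive (S.P_proj 3 0)]
  refine ⟨extractA (1 - (2 : ℝ) • S.P 3 0) (S.P 2), extractB U p (S.Q 2 2),
    sum_conjTranspose_mul_extractA hR (S.P_sa 2) (S.P_proj 2) (S.P_complete 2),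
    sum_conjTranspose_mul_extractB hUU hps hpp (S.Q_sa 2 2) (S.Q_proj 2 2), ?_, ?_, ?_, n1, n2⟩
  all_goals
    clear n1 n2
    simp only [actA_eq] at hp1 hp0 hU hq ⊢
  all_goals
    have hPa (a b : Fin 3) : tensorLeft (Fin dA) (Fin dB) (S.P 2 a) *ᵥ
        tensorLeft (Fin dA) (Fin dB) (S.P 2 b) *ᵥ S.ψ =
          if a = b then tensorLeft (Fin dA) (Fin dB) (S.P 2 b) *ᵥ S.ψ else 0 := by
      rw [mulVec_mulVec, ← map_mul]
      split_ifs with h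
      · rw [h, S.P_proj]
      · rw [mul_eq_zero_of_measurement (S.P_proj 2) (S.P_complete 2) h, map_zero, zero_mulVec]
    have hqa (b : Fin 3) : tensorRight (Fin dA) (Fin dB) (S.Q 2 2) *ᵥ
        tensorLeft (Fin dA) (Fin dB) (S.P 2 b) *ᵥ S.ψ =
          if b = 2 then tensorLeft (Fin dA) (Fin dB) (S.P 2 2) *ᵥ S.ψ else 0 := by
      rw [mulVec_mulVec, tensorRight_mul_tensorLeft, ← mulVec_mulVec, hq, hPa]
    intro s t
  · have hB : tensorRight (Fin dA) (Fin dB) (extractB U p (S.Q 2 2) t) *ᵥ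
        tensorLeft (Fin dA) (Fin dB) (S.P 2 0) *ᵥ S.ψ = if t = 0 then
          tensorRight (Fin dA) (Fin dB) U *ᵥ tensorLeft (Fin dA) (Fin dB) (S.P 2 0) *ᵥ S.ψ
          else 0 := by
      fin_cases t <;> simp [extractB, ← mulVec_mulVec, sub_mulVec, hqa, hp0]
    rw [← tensorLeft_mul_tensorRight, ← mulVec_mulVec, hB]
    by_cases ht : t = 0
    · rw [if_pos ht, mulVec_mulVec, ← tensorRight_mul_tensorLeft, ← mulVec_mulVec]
      fin_cases s
      · simp only [extractA, Fin.zero_eta, cons_val_zero, map_mul, ← mulVec_mulVec, hPa, if_pos,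
          ht, and_self]
        rw [mulVec_mulVec, tensorRight_mul_tensorLeft, hU]
      · simp [extractA, hPa]
      · simp [extractA, hPa]
    · simp [ht]
  · have hB : tensorRight (Fin dA) (Fin dB) (extractB U p (S.Q 2 2) t) *ᵥ
        tensorLeft (Fin dA) (Fin dB) (S.P 2 1) *ᵥ S.ψ = if t = 1 then
          tensorLeft (Fin dA) (Fin dB) (S.P 2 1) *ᵥ S.ψ else 0 := by
      fin_cases t <;> simp [extractB, ← mulVec_mulVec, sub_mulVec, hqa, hp1]
    rw [← tensorLeft_mul_tensorRight, ← mulVec_mulVec, hB]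
    by_cases ht : t = 1
    · fin_cases s <;> simp [extractA, ← mulVec_mulVec, hPa, ht]
    · simp [ht]
  · have hB : tensorRight (Fin dA) (Fin dB) (extractB U p (S.Q 2 2) t) *ᵥ
        tensorLeft (Fin dA) (Fin dB) (S.P 2 2) *ᵥ S.ψ = if t = 2 then
          tensorLeft (Fin dA) (Fin dB) (S.P 2 2) *ᵥ S.ψ else 0 := by
      fin_cases t <;> simp [extractB, ← mulVec_mulVec, sub_mulVec, hqa]
    rw [← tensorLeft_mul_tensorRight, ← mulVec_mulVec, hB]
    by_cases ht : t = 2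
    · fin_cases s <;> simp [extractA, ← mulVec_mulVec, hPa, ht]
    · simp [ht]

end Sep

open Sep in
/-- second self-testing decomposition. Any finite-dimensional strategy
inducing `p*` admits local isometries `V_A, V_B` extracting the state
`√(1-α²)|22⟩ ⊗ χ'' + (α/√(1+α²))(|11⟩ + α|00⟩) ⊗ χ'`, with `(P_2^a ⊗ I)ψ` mapped to the
corresponding components. -/
theorem second_self_testing_decomposition
    (α : ℝ) (hα0 : 0 < α) (hα1 : α < 1)
    {dA dB : ℕ} (hdA : 1 ≤ dA) (hdB : 1 ≤ dB) (S : Strategy dA dB)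
    (hind : ∀ x y a b, induced S x y a b = (pstar α x y a b : ℂ)) :
    ∃ (kA kB : ℕ), 1 ≤ kA ∧ 1 ≤ kB ∧
    ∃ (VA : Matrix (Fin 3 × Fin kA) (Fin dA) ℂ) (VB : Matrix (Fin 3 × Fin kB) (Fin dB) ℂ)
      (χ' χ'' : Fin kA × Fin kB → ℂ),
      VAᴴ * VA = 1 ∧ VBᴴ * VB = 1 ∧
      (∑ p : Fin kA × Fin kB, Complex.normSq (χ' p) = 1) ∧
      (∑ p : Fin kA × Fin kB, Complex.normSq (χ'' p) = 1) ∧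
      (∀ (s t : Fin 3) (k : Fin kA) (l : Fin kB),
        (∑ i, ∑ j, VA (s, k) i * VB (t, l) j * S.ψ (i, j))
          = ((Real.sqrt (1 - α ^ 2) : ℝ) : ℂ) *
              (if s = 2 ∧ t = 2 then 1 else 0) * χ'' (k, l)
            + ((α / Real.sqrt (1 + α ^ 2) : ℝ) : ℂ) *
              (if s = 1 ∧ t = 1 then 1 else if s = 0 ∧ t = 0 then (α : ℂ) else 0)
              * χ' (k, l)) ∧
      (∀ (s t : Fin 3) (k : Fin kA) (l : Fin kB),
        (∑ i, ∑ j, VA (s, k) i * VB (t, l) j * actA (S.P 2 0) S.ψ (i, j))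
          = ((α ^ 2 / Real.sqrt (1 + α ^ 2) : ℝ) : ℂ) *
              (if s = 0 ∧ t = 0 then 1 else 0) * χ' (k, l)) ∧
      (∀ (s t : Fin 3) (k : Fin kA) (l : Fin kB),
        (∑ i, ∑ j, VA (s, k) i * VB (t, l) j * actA (S.P 2 1) S.ψ (i, j))
          = ((α / Real.sqrt (1 + α ^ 2) : ℝ) : ℂ) *
              (if s = 1 ∧ t = 1 then 1 else 0) * χ' (k, l)) ∧
      (∀ (s t : Fin 3) (k : Fin kA) (l : Fin kB),
        (∑ i, ∑ j, VA (s, k) i * VB (t, l) j * actA (S.P 2 2) S.ψ (i, j))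
          = ((Real.sqrt (1 - α ^ 2) : ℝ) : ℂ) *
              (if s = 2 ∧ t = 2 then 1 else 0) * χ'' (k, l)) := by
  obtain ⟨A, B, hA, hB, h0, h1, h2, n1, n2⟩ := S.exists_extraction_maps hα0 hα1 hind
  have hsum : S.ψ = actA (S.P 2 0) S.ψ + actA (S.P 2 1) S.ψ + actA (S.P 2 2) S.ψ := by
    rw [actA_eq, actA_eq, actA_eq, ← add_mulVec, ← add_mulVec, ← map_add, ← map_add,
      ← Fin.sum_univ_three (S.P 2), S.P_complete, map_one, one_mulVec]
  have hp : 0 < 1 + α ^ 2 := by positivity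
  have hm : 0 < 1 - α ^ 2 := by nlinarith
  have hp' : (((√(1 + α ^ 2) : ℝ)) : ℂ) ≠ 0 :=
    Complex.ofReal_ne_zero.mpr (Real.sqrt_pos.mpr hp).ne'
  have hm' : (((√(1 - α ^ 2) : ℝ)) : ℂ) ≠ 0 :=
    Complex.ofReal_ne_zero.mpr (Real.sqrt_pos.mpr hm).ne'
  have hα' : (α : ℂ) ≠ 0 := Complex.ofReal_ne_zero.mpr hα0.ne'
  refine ⟨dA, dB, hdA, hdB, of fun sk i => A sk.1 sk.2 i, of fun sk i => B sk.1 sk.2 i,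
    fun i => ((√(1 + α ^ 2) / α : ℝ) : ℂ) * actA (S.P 2 1) S.ψ i,
    fun i => (((√(1 - α ^ 2))⁻¹ : ℝ) : ℂ) * actA (S.P 2 2) S.ψ i,
    conjTranspose_mul_self_of_sum hA, conjTranspose_mul_self_of_sum hB, ?_, ?_, ?_, ?_, ?_, ?_⟩
  · simp only [Complex.normSq_mul, Complex.normSq_ofReal, ← Finset.mul_sum, n1]
    rw [div_mul_div_comm, Real.mul_self_sqrt hp.le]
    field_simp
  · simp only [Complex.normSq_mul, Complex.normSq_ofReal, ← Finset.mul_sum, n2]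
    rw [← mul_inv, Real.mul_self_sqrt hm.le, inv_mul_cancel₀ hm.ne']
  all_goals
    intro s t k l
    simp only [of_apply]
    rw [sum_sum_mul_mul_eq]
  · conv_lhs => rw [hsum, mulVec_add, mulVec_add, h0, h1, h2]
    have e₀ : (if s = 0 ∧ t = 0 then α • actA (S.P 2 1) S.ψ else 0) (k, l) =
        (if s = 0 ∧ t = 0 then (α : ℂ) else 0) * actA (S.P 2 1) S.ψ (k, l) := by
      split_ifs <;> simp
    have e₁ : (if s = 1 ∧ t = 1 then actA (S.P 2 1) S.ψ else 0) (k, l) =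
        (if s = 1 ∧ t = 1 then 1 else 0) * actA (S.P 2 1) S.ψ (k, l) := by
      split_ifs <;> simp
    have e₂ : (if s = 2 ∧ t = 2 then actA (S.P 2 2) S.ψ else 0) (k, l) =
        (if s = 2 ∧ t = 2 then 1 else 0) * actA (S.P 2 2) S.ψ (k, l) := by
      split_ifs <;> simp
    have e₃ : (if s = 1 ∧ t = 1 then 1 else if s = 0 ∧ t = 0 then (α : ℂ) else 0) =
        (if s = 1 ∧ t = 1 then 1 else 0) + if s = 0 ∧ t = 0 then (α : ℂ) else 0 := by
      by_cases h : s = 1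
      · simp [h]
      · simp [h]
    rw [Pi.add_apply, Pi.add_apply, e₀, e₁, e₂, e₃]
    push_cast
    field_simp
    ring
  · rw [h0]
    split_ifs
    · push_cast
      simp only [Pi.smul_apply, Complex.real_smul]
      field_simp
    · simp
  · rw [h1]
    split_ifs
    · push_cast
      field_simp
    · simp
  · rw [h2]
    split_ifs
    · push_cast
      field_simp
    · simp
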